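/- The composed hardware monitor HW-Mod of VRASED simultaneously satisfies all of LTL Specifications (1)–(10). Precisely: run the four FSMs of VRASED (the key access-control FSM, the atomicity FSM, the exclusive-stack FSM, and the DMA FSM, each with the transition functions defined in the context, each started in its Reset state with s(t+1) = δ(s(t), inputs(t+1))) on the same input trace, and define the composed output reset(t) as the disjunction of the four sub-module reset outputs. If the input trace satisfies Axiom A4 and 0 < CR_min < CR_max, then the trace together with the composed reset satisfies, at every time: (1) ¬(PC ∈ CR) ∧ R_en ∧ (D_addr ∈ KR) → reset; (2) ¬reset ∧ (PC ∈ CR) ∧ ¬(X(PC) ∈ CR) → PC = CR_max ∨ X(reset); (3) ¬reset ∧ ¬(PC ∈ CR) ∧ (X(PC) ∈ CR) → X(PC) = CR_min ∨ X(reset); (4) irq ∧ (PC ∈ CR) → reset; (5) ¬(PC ∈ CR) ∧ (R_en ∨ W_en) ∧ (D_addr ∈ XS) → reset; (6) (PC ∈ CR) ∧ W_en ∧ ¬(D_addr ∈ XS) ∧ ¬(D_addr ∈ MR) → reset; (7) DMA_en ∧ (DMA_addr ∈ KR) → reset; (8) DMA_en ∧ (DMA_addr ∈ XS) → reset; (9)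 (PC ∈ CR) ∧ DMA_en → reset; and (10) reset → (reset U PC = 0) ∨ G(reset). -/

import Mathlib

/-- States of a two-state Run/Reset monitor FSM. -/
inductive S2 where
  | Run : S2
  | Reset : S2
deriving DecidableEq

-- Transition function of a two-state Run/Reset monitor: from `Run` it moves to
-- `Reset` exactly when the violation condition `V` holds of the current inputs, and
-- from `Reset` it moves back to `Run` exactly when `PC = 0`.
open Classical in
noncomputable def twoStateDelta (V : ℕ → Prop) (PC : ℕ → ℕ) : S2 → ℕ → S2
  | S2.Run, t => if V t then S2.Reset else S2.Run
  | S2.Reset, t => if PC t = 0 then S2.Run else S2.Reset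

/-- States of the atomicity/controlled-invocation FSM of VRASED. -/
inductive S5 where
  | notCR : S5
  | fstCR : S5
  | midCR : S5
  | lstCR : S5
  | Reset : S5
deriving DecidableEq

-- Transition function of the atomicity/controlled-invocation FSM, on inputs (PC, irq).
open Classical in
noncomputable def atomDelta (CRmin CRmax : ℕ) (PC : ℕ → ℕ) (irq : ℕ → Prop) :
    S5 → ℕ → S5
  | S5.notCR, t =>
      if PC t < CRmin ∨ PC t > CRmax then S5.notCR
      else if PC t = CRmin ∧ ¬ irq t then S5.fstCR
      else S5.Reset
  | S5.fstCR, t =>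
      if PC t = CRmin ∧ ¬ irq t then S5.fstCR
      else if (CRmin < PC t ∧ PC t < CRmax) ∧ ¬ irq t then S5.midCR
      else S5.Reset
  | S5.midCR, t =>
      if (CRmin < PC t ∧ PC t < CRmax) ∧ ¬ irq t then S5.midCR
      else if PC t = CRmax ∧ ¬ irq t then S5.lstCR
      else S5.Reset
  | S5.lstCR, t =>
      if PC t = CRmax ∧ ¬ irq t then S5.lstCR
      else if (PC t < CRmin ∨ PC t > CRmax) ∧ ¬ irq t then S5.notCR
      else S5.Reset
  | S5.Reset, t =>
      if PC t = 0 then S5.notCR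
      else S5.Reset

/-- If every violation excludes `PC = 0`, a two-state monitor is in `Reset` at each violation. -/
theorem twoState_reset_of_violation {V : ℕ → Prop} {PC : ℕ → ℕ} {s : ℕ → S2}
    (h0 : s 0 = S2.Reset) (hs : ∀ t, s (t + 1) = twoStateDelta V PC (s t) (t + 1))
    (hV : ∀ t, V t → PC t ≠ 0) (t : ℕ) (ht : V t) : s t = S2.Reset := by
  cases t with
  | zero => exact h0
  | succ t =>
    rw [hs]
    cases s t <;> simp [twoStateDelta, ht, hV _ ht]

/-- A two-state monitor stays in `Reset` as long as `PC ≠ 0`. -/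
theorem twoState_reset_succ {V : ℕ → Prop} {PC : ℕ → ℕ} {s : ℕ → S2}
    (hs : ∀ t, s (t + 1) = twoStateDelta V PC (s t) (t + 1))
    (t : ℕ) (ht : s t = S2.Reset) (hPC : PC (t + 1) ≠ 0) : s (t + 1) = S2.Reset := by
  rw [hs, ht]
  simp [twoStateDelta, hPC]

/-- The program-counter and interrupt constraints attached to each atomicity state. -/
def atomInvariant (CRmin CRmax : ℕ) (PC : ℕ) (irq : Prop) : S5 → Prop
  | S5.notCR => PC < CRmin ∨ CRmax < PC
  | S5.fstCR => PC = CRmin ∧ ¬irq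
  | S5.midCR => (CRmin < PC ∧ PC < CRmax) ∧ ¬irq
  | S5.lstCR => PC = CRmax ∧ ¬irq
  | S5.Reset => True

theorem atomInvariant_delta {CRmin CRmax : ℕ} (hCR : 0 < CRmin) (PC : ℕ → ℕ)
    (irq : ℕ → Prop) (q : S5) (t : ℕ) :
    atomInvariant CRmin CRmax (PC t) (irq t) (atomDelta CRmin CRmax PC irq q t) := by
  cases q <;> simp only [atomDelta] <;> split_ifs <;> simp only [atomInvariant] <;> grind

theorem atomInvariant_run {CRmin CRmax : ℕ} (hCR : 0 < CRmin) {PC : ℕ → ℕ}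
    {irq : ℕ → Prop} {s : ℕ → S5} (h0 : s 0 = S5.Reset)
    (hs : ∀ t, s (t + 1) = atomDelta CRmin CRmax PC irq (s t) (t + 1)) (t : ℕ) :
    atomInvariant CRmin CRmax (PC t) (irq t) (s t) := by
  cases t with
  | zero => simp [h0, atomInvariant]
  | succ t => rw [hs]; exact atomInvariant_delta hCR PC irq _ _

/-- A property that persists until `Q` holds satisfies `(P U Q) ∨ G P`. -/
theorem until_or_always_of_persist {P Q : ℕ → Prop}
    (hstep : ∀ t, P t → ¬Q (t + 1) → P (t + 1)) (t : ℕ) (ht : P t) :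
    (∃ t', t ≤ t' ∧ Q t' ∧ ∀ u, t ≤ u → u < t' → P u) ∨ (∀ u, t ≤ u → P u) := by
  classical
  by_cases h : ∃ t', t ≤ t' ∧ Q t'
  · refine Or.inl ⟨Nat.find h, (Nat.find_spec h).1, (Nat.find_spec h).2, fun u hu => ?_⟩
    induction u, hu using Nat.le_induction with
    | base => exact fun _ => ht
    | succ u hu ih =>
      intro hlt
      exact hstep u (ih (by omega)) fun hQ => Nat.find_min h hlt ⟨by omega, hQ⟩
  · refine Or.inr fun u hu => ?_
    induction u, hu using Nat.le_induction with
    | base => exact ht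
    | succ u hu ih => exact hstep u ih fun hQ => h ⟨u + 1, by omega, hQ⟩

/-- the composed hardware monitor HW-Mod of VRASED (the four sub-module
FSMs run on the same input trace, with composed output
reset(t) := reset_keyAC(t) ∨ reset_atom(t) ∨ reset_stack(t) ∨ reset_DMA(t))
simultaneously satisfies LTL Specifications (1)–(10) at every time, provided the
input trace satisfies Axiom A4 and 0 < CR_min < CR_max. -/
theorem hwmod_composition_satisfies_all_specs
    (CRmin CRmax Kmin Kmax XSmin XSmax MRmin MRmax : ℕ)
    (hCR : 0 < CRmin ∧ CRmin < CRmax)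
    (PC Daddr DMAaddr : ℕ → ℕ)
    (irq Ren Wen DMAen : ℕ → Prop)
    -- key access-control FSM run:
    (s1 : ℕ → S2)
    (hs1_0 : s1 0 = S2.Reset)
    (hs1 : ∀ t : ℕ, s1 (t + 1) =
      twoStateDelta
        (fun u => ¬(CRmin ≤ PC u ∧ PC u ≤ CRmax) ∧ Ren u ∧ (Kmin ≤ Daddr u ∧ Daddr u ≤ Kmax))
        PC (s1 t) (t + 1))
    -- atomicity FSM run:
    (s2 : ℕ → S5)
    (hs2_0 : s2 0 = S5.Reset)
    (hs2 : ∀ t : ℕ, s2 (t + 1) = atomDelta CRmin CRmax PC irq (s2 t) (t + 1))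
    -- exclusive-stack FSM run:
    (s3 : ℕ → S2)
    (hs3_0 : s3 0 = S2.Reset)
    (hs3 : ∀ t : ℕ, s3 (t + 1) =
      twoStateDelta
        (fun u =>
          (¬(CRmin ≤ PC u ∧ PC u ≤ CRmax) ∧ (Ren u ∨ Wen u) ∧
            (XSmin ≤ Daddr u ∧ Daddr u ≤ XSmax)) ∨
          ((CRmin ≤ PC u ∧ PC u ≤ CRmax) ∧ Wen u ∧
            ¬(XSmin ≤ Daddr u ∧ Daddr u ≤ XSmax) ∧
            ¬(MRmin ≤ Daddr u ∧ Daddr u ≤ MRmax)))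
        PC (s3 t) (t + 1))
    -- DMA FSM run:
    (s4 : ℕ → S2)
    (hs4_0 : s4 0 = S2.Reset)
    (hs4 : ∀ t : ℕ, s4 (t + 1) =
      twoStateDelta
        (fun u =>
          (DMAen u ∧ (Kmin ≤ DMAaddr u ∧ DMAaddr u ≤ Kmax)) ∨
          (DMAen u ∧ (XSmin ≤ DMAaddr u ∧ DMAaddr u ≤ XSmax)) ∨
          ((CRmin ≤ PC u ∧ PC u ≤ CRmax) ∧ DMAen u))
        PC (s4 t) (t + 1))
    -- composed reset output:
    (Rst : ℕ → Prop)
    (hRst : ∀ t : ℕ, Rst t ↔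
      (s1 t = S2.Reset ∨ s2 t = S5.Reset ∨ s3 t = S2.Reset ∨ s4 t = S2.Reset))
    -- Axiom A4:
    (hA4 : ∀ t : ℕ, PC t = 0 → ¬Ren t ∧ ¬Wen t ∧ ¬DMAen t ∧ ¬irq t) :
    ∀ t : ℕ,
      -- (1)
      ((¬(CRmin ≤ PC t ∧ PC t ≤ CRmax) ∧ Ren t ∧ (Kmin ≤ Daddr t ∧ Daddr t ≤ Kmax)) →
        Rst t) ∧
      -- (2)
      ((¬Rst t ∧ (CRmin ≤ PC t ∧ PC t ≤ CRmax) ∧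
          ¬(CRmin ≤ PC (t + 1) ∧ PC (t + 1) ≤ CRmax)) →
        (PC t = CRmax ∨ Rst (t + 1))) ∧
      -- (3)
      ((¬Rst t ∧ ¬(CRmin ≤ PC t ∧ PC t ≤ CRmax) ∧
          (CRmin ≤ PC (t + 1) ∧ PC (t + 1) ≤ CRmax)) →
        (PC (t + 1) = CRmin ∨ Rst (t + 1))) ∧
      -- (4)
      ((irq t ∧ (CRmin ≤ PC t ∧ PC t ≤ CRmax)) → Rst t) ∧
      -- (5)
      ((¬(CRmin ≤ PC t ∧ PC t ≤ CRmax) ∧ (Ren t ∨ Wen t) ∧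
          (XSmin ≤ Daddr t ∧ Daddr t ≤ XSmax)) → Rst t) ∧
      -- (6)
      (((CRmin ≤ PC t ∧ PC t ≤ CRmax) ∧ Wen t ∧
          ¬(XSmin ≤ Daddr t ∧ Daddr t ≤ XSmax) ∧
          ¬(MRmin ≤ Daddr t ∧ Daddr t ≤ MRmax)) → Rst t) ∧
      -- (7)
      ((DMAen t ∧ (Kmin ≤ DMAaddr t ∧ DMAaddr t ≤ Kmax)) → Rst t) ∧
      -- (8)
      ((DMAen t ∧ (XSmin ≤ DMAaddr t ∧ DMAaddr t ≤ XSmax)) → Rst t) ∧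
      -- (9)
      (((CRmin ≤ PC t ∧ PC t ≤ CRmax) ∧ DMAen t) → Rst t) ∧
      -- (10)
      (Rst t →
        ((∃ t', t ≤ t' ∧ PC t' = 0 ∧ ∀ u, t ≤ u → u < t' → Rst u) ∨
         (∀ u, t ≤ u → Rst u))) := by
  have v1 := twoState_reset_of_violation hs1_0 hs1 (fun t h h0 => (hA4 t h0).1 h.2.1)
  have v3 := twoState_reset_of_violation hs3_0 hs3 (fun t h h0 => by
    have := hA4 t h0
    tauto)
  have v4 := twoState_reset_of_violation hs4_0 hs4 (fun t h h0 => by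
    have := hA4 t h0
    tauto)
  have inv := atomInvariant_run hCR.1 hs2_0 hs2
  intro t
  refine ⟨fun h => (hRst t).2 (Or.inl (v1 t h)), ?_, ?_, ?_,
    fun h => (hRst t).2 (Or.inr (Or.inr (Or.inl (v3 t (Or.inl h))))),
    fun h => (hRst t).2 (Or.inr (Or.inr (Or.inl (v3 t (Or.inr h))))),
    fun h => (hRst t).2 (Or.inr (Or.inr (Or.inr (v4 t (Or.inl h))))),
    fun h => (hRst t).2 (Or.inr (Or.inr (Or.inr (v4 t (Or.inr (Or.inl h)))))),
    fun h => (hRst t).2 (Or.inr (Or.inr (Or.inr (v4 t (Or.inr (Or.inr h)))))), ?_⟩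
  · rintro ⟨hr, hin, hout⟩
    have hi := inv t
    have hd := hs2 t
    rw [hRst] at hr ⊢
    cases hq : s2 t <;> rw [hq] at hi hd <;>
      simp only [atomInvariant, atomDelta] at hi hd <;> grind
  · rintro ⟨hr, hout, hin⟩
    have hi := inv t
    have hd := hs2 t
    rw [hRst] at hr ⊢
    cases hq : s2 t <;> rw [hq] at hi hd <;>
      simp only [atomInvariant, atomDelta] at hi hd <;> grind
  · rintro ⟨hirq, hin⟩
    have hi := inv t
    rw [hRst]
    cases hq : s2 t <;> rw [hq] at hi <;> simp only [atomInvariant] at hi <;> grind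
  · refine until_or_always_of_persist (Q := fun u => PC u = 0) (fun u hu hPC => ?_) t
    rw [hRst] at hu ⊢
    rcases hu with h | h | h | h
    · exact Or.inl (twoState_reset_succ hs1 u h hPC)
    · refine Or.inr (Or.inl ?_)
      rw [hs2, h]
      simp [atomDelta, hPC]
    · exact Or.inr (Or.inr (Or.inl (twoState_reset_succ hs3 u h hPC)))
    · exact Or.inr (Or.inr (Or.inr (twoState_reset_succ hs4 u h hPC)))
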